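/- arXiv:1907.00470 — 2 statements merged into one kernel-verified Lean document; each statement's English description precedes it below -/
import Mathlib

section
/- Let A be a type, let k ≥ 4 be even, and let d₀, …, d_k : A⁴ → A be a distributivity sequence of length k. Let α, β, γ be equivalence relations on A, each compatible with every d_i. Then α ∩ (β ∘ γ ∘ β) ⊆ (α ∩ β) ∘_r (α ∩ γ), where r = (k² − 3k + 4)/2. -/
/-- Relational composition: `RComp ρ σ a c` iff there is `b` with `ρ a b` and `σ b c`. -/
def RComp {A : Type*} (ρ σ : A → A → Prop) : A → A → Prop :=
  fun a c => ∃ b, ρ a b ∧ σ b c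

/-- Alternating composition `ρ ∘_h σ` with `h` factors, starting with `ρ`
(the value at `0` is irrelevant; the notion is used for `h ≥ 1`). -/
def AltComp {A : Type*} (ρ σ : A → A → Prop) : ℕ → (A → A → Prop)
  | 0 => ρ
  | 1 => ρ
  | (n+2) => RComp ρ (AltComp σ ρ (n+1))

/-- Intersection of binary relations. -/
def RInter {A : Type*} (ρ σ : A → A → Prop) : A → A → Prop :=
  fun a b => ρ a b ∧ σ a b

/-- Converse of a binary relation. -/
def RConv {A : Type*} (ρ : A → A → Prop) : A → A → Prop :=
  fun a b => ρ b a

/-- A binary relation `θ` is compatible with a 4-ary operation `f`. -/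
def Compat4 {A : Type*} (θ : A → A → Prop) (f : A → A → A → A → A) : Prop :=
  ∀ a₁ a₂ a₃ a₄ b₁ b₂ b₃ b₄, θ a₁ b₁ → θ a₂ b₂ → θ a₃ b₃ → θ a₄ b₄ →
    θ (f a₁ a₂ a₃ a₄) (f b₁ b₂ b₃ b₄)

/-- `d 0, …, d k` is a distributivity sequence of length `k`. -/
def IsDistribSeq {A : Type*} (k : ℕ) (d : ℕ → A → A → A → A → A) : Prop :=
  (∀ x y z w, d 0 x y z w = x) ∧
  (∀ i, i < k → Even i → ∀ x w, d i x x w w = d (i+1) x x w w) ∧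
  (∀ i, i < k → Even i → ∀ x y z, d i x y z x = d (i+1) x y z x) ∧
  (∀ i, i < k → Odd i → ∀ x y w, d i x y y w = d (i+1) x y y w) ∧
  (∀ x y z w, d k x y z w = w)

section AltComp

variable {A : Type*}

/-- A point sequence whose consecutive steps alternate between `ρ` and `σ` witnesses `AltComp`. -/
theorem AltComp.of_seq (n : ℕ) : ∀ {ρ σ : A → A → Prop} (f : ℕ → A),
    (∀ i ≤ n, Even i → ρ (f i) (f (i + 1))) → (∀ i ≤ n, Odd i → σ (f i) (f (i + 1))) →
    AltComp ρ σ (n + 1) (f 0) (f (n + 1)) := by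
  induction n with
  | zero => exact fun f hρ _ => hρ 0 le_rfl Even.zero
  | succ n ih =>
    intro ρ σ f hρ hσ
    refine ⟨f 1, hρ 0 (by omega) Even.zero, ih (fun i => f (i + 1)) ?_ ?_⟩
    · exact fun i hi h => hσ (i + 1) (by omega) h.add_one
    · exact fun i hi h => hρ (i + 1) (by omega) h.add_one

theorem AltComp.head {ρ σ : A → A → Prop} (hρ : ∀ {x y z}, ρ x y → ρ y z → ρ x z) {n : ℕ}
    {a b c : A} (hab : ρ a b) (h : AltComp ρ σ (n + 1) b c) : AltComp ρ σ (n + 1) a c := by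
  cases n with
  | zero => exact hρ hab h
  | succ n =>
    obtain ⟨x, hbx, hx⟩ := h
    exact ⟨x, hρ hab hbx, hx⟩

/-- Concatenation of alternating compositions whose adjacent factors coincide: they merge. -/
theorem AltComp.append {n : ℕ} {b c : A} (m : ℕ) : ∀ {ρ σ : A → A → Prop} {a : A},
    (∀ {x y z}, ρ x y → ρ y z → ρ x z) → (∀ {x y z}, σ x y → σ y z → σ x z) →
    AltComp ρ σ (m + 1) a b → (Even m → AltComp ρ σ (n + 1) b c) →
    (Odd m → AltComp σ ρ (n + 1) b c) → AltComp ρ σ (m + n + 1) a c := by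
  induction m with
  | zero =>
    intro ρ σ a hρ _ h he _
    simpa using AltComp.head (ρ := ρ) (σ := σ) hρ h (he Even.zero)
  | succ m ih =>
    rintro ρ σ a hρ hσ ⟨x, hax, hx⟩ he ho
    have := ih (ρ := σ) (σ := ρ) hσ hρ hx (fun h => ho h.add_one) (fun h => he h.add_one)
    rw [show m + 1 + n + 1 = m + n + 2 by omega]
    exact ⟨x, hax, this⟩

end AltComp

theorem Equivalence.rInter {A : Type*} {ρ σ : A → A → Prop} (hρ : Equivalence ρ)
    (hσ : Equivalence σ) : Equivalence (RInter ρ σ) :=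
  ⟨fun x => ⟨hρ.refl x, hσ.refl x⟩, fun h => ⟨hρ.symm h.1, hσ.symm h.2⟩,
    fun h h' => ⟨hρ.trans h.1 h'.1, hσ.trans h.2 h'.2⟩⟩

namespace IsDistribSeq

variable {A : Type*} {k : ℕ} {d : ℕ → A → A → A → A → A} {α β γ : A → A → Prop}

theorem apply_self (hd : IsDistribSeq k d) (x y : A) : ∀ i ≤ k, d i x y y x = x := by
  intro i
  induction i with
  | zero => exact fun _ => hd.1 ..
  | succ i ih =>
    intro hi
    rw [← ih (by omega)]
    rcases Nat.even_or_odd i with h | h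
    · rw [← hd.2.2.1 i hi h, ih (by omega), ih (by omega)]
    · rw [← hd.2.2.2.1 i hi h, ih (by omega), ih (by omega)]

theorem rel_apply (hd : IsDistribSeq k d) (hα : Equivalence α) {i : ℕ} (hi : i ≤ k)
    (hcα : Compat4 α (d i)) {p q s t : A} (hpt : α p t) (hqs : α q s) :
    α p (d i p q s t) := by
  simpa only [hd.apply_self p q i hi] using
    hcα p q q p p q s t (hα.refl p) (hα.refl q) hqs hpt

theorem even_step (hd : IsDistribSeq k d) (hβ : Equivalence β) (hcβ : ∀ i ≤ k, Compat4 β (d i))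
    {p q s t : A} (hpq : β p q) (hst : β s t) {i : ℕ} (hi : i < k) (h : Even i) :
    β (d i p q s t) (d (i + 1) p q s t) := by
  refine hβ.trans (hcβ i hi.le p q s t p p t t (hβ.refl p) (hβ.symm hpq) hst (hβ.refl t)) ?_
  rw [hd.2.1 i hi h]
  exact hcβ (i + 1) hi p p t t p q s t (hβ.refl p) hpq (hβ.symm hst) (hβ.refl t)

theorem even_step_outer (hd : IsDistribSeq k d) (hα : Equivalence α)
    (hcα : ∀ i ≤ k, Compat4 α (d i)) {p q s t : A} (hpt : α p t) {i : ℕ} (hi : i < k)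
    (h : Even i) : α (d i p q s t) (d (i + 1) p q s t) := by
  refine hα.trans (hcα i hi.le p q s t p q s p (hα.refl p) (hα.refl q) (hα.refl s)
    (hα.symm hpt)) ?_
  rw [hd.2.2.1 i hi h]
  exact hcα (i + 1) hi p q s p p q s t (hα.refl p) (hα.refl q) (hα.refl s) hpt

theorem odd_step (hd : IsDistribSeq k d) (hγ : Equivalence γ) (hcγ : ∀ i ≤ k, Compat4 γ (d i))
    {p q s t : A} (hqs : γ q s) {i : ℕ} (hi : i < k) (h : Odd i) :
    γ (d i p q s t) (d (i + 1) p q s t) := by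
  refine hγ.trans (hcγ i hi.le p q s t p q q t (hγ.refl p) (hγ.refl q) (hγ.symm hqs)
    (hγ.refl t)) ?_
  rw [hd.2.2.2.1 i hi h]
  exact hcγ (i + 1) hi p q q t p q s t (hγ.refl p) (hγ.refl q) hqs (hγ.refl t)

theorem seq_steps (hd : IsDistribSeq k d) (hα : Equivalence α) (hβ : Equivalence β)
    (hγ : Equivalence γ) (hcα : ∀ i ≤ k, Compat4 α (d i)) (hcβ : ∀ i ≤ k, Compat4 β (d i))
    (hcγ : ∀ i ≤ k, Compat4 γ (d i)) {p q s t : A} (hpt : α p t) (hpq : γ p q)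
    (hqs : RInter α β q s) (hst : γ s t) {i : ℕ} (hi : i < k) :
    (Even i → RInter α γ (d i p q s t) (d (i + 1) p q s t)) ∧
      (Odd i → RInter α β (d i p q s t) (d (i + 1) p q s t)) := by
  have hstep : α (d i p q s t) (d (i + 1) p q s t) :=
    hα.trans (hα.symm (hd.rel_apply hα hi.le (hcα i hi.le) hpt hqs.1))
      (hd.rel_apply hα hi (hcα (i + 1) hi) hpt hqs.1)
  exact ⟨fun h => ⟨hstep, hd.even_step hγ hcγ hpq hst hi h⟩,
    fun h => ⟨hstep, hd.odd_step hβ hcβ hqs.2 hi h⟩⟩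

theorem altComp_of_inner (hd : IsDistribSeq k d) (hα : Equivalence α) (hβ : Equivalence β)
    (hγ : Equivalence γ) (hcα : ∀ i ≤ k, Compat4 α (d i)) (hcβ : ∀ i ≤ k, Compat4 β (d i))
    (hcγ : ∀ i ≤ k, Compat4 γ (d i)) (hk : 0 < k) {p q s t : A} (hpt : α p t) (hpq : γ p q)
    (hqs : RInter α β q s) (hst : γ s t) : AltComp (RInter α γ) (RInter α β) k p t := by
  have hsteps := fun i (hi : i < k) =>
    hd.seq_steps hα hβ hγ hcα hcβ hcγ hpt hpq hqs hst hi
  obtain ⟨n, rfl⟩ : ∃ n, k = n + 1 := ⟨k - 1, by omega⟩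
  have := AltComp.of_seq n (fun i => d i p q s t) (fun i hi => (hsteps i (by omega)).1)
    (fun i hi => (hsteps i (by omega)).2)
  simpa only [hd.1, hd.2.2.2.2] using this

theorem altComp_of_inner_swap (hd : IsDistribSeq k d) (hα : Equivalence α) (hβ : Equivalence β)
    (hγ : Equivalence γ) (hcα : ∀ i ≤ k, Compat4 α (d i)) (hcβ : ∀ i ≤ k, Compat4 β (d i))
    (hcγ : ∀ i ≤ k, Compat4 γ (d i)) (hk : 0 < k) (hkeven : Even k) {p q s t : A}
    (hpt : α p t) (hpq : γ p q) (hqs : RInter α β q s) (hst : γ s t) :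
    AltComp (RInter α β) (RInter α γ) k p t := by
  have hsteps := fun i (hi : i < k) => hd.seq_steps hα hβ hγ hcα hcβ hcγ (hα.symm hpt)
    (hγ.symm hst) ((hα.rInter hβ).symm hqs) (hγ.symm hpq) hi
  obtain ⟨n, rfl⟩ : ∃ n, k = n + 1 := ⟨k - 1, by omega⟩
  have hn : Odd n := by simpa [Nat.even_add_one] using hkeven
  have := AltComp.of_seq (ρ := RInter α β) (σ := RInter α γ) n
    (fun i => d (n + 1 - i) t s q p) ?_ ?_
  · simpa only [Nat.sub_zero, Nat.sub_self, hd.1, hd.2.2.2.2] using this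
  · intro i hi h
    have := (hsteps (n - i) (by omega)).2 (Nat.Odd.sub_even hi hn h)
    simpa only [Nat.add_sub_add_right, Nat.sub_add_comm hi] using (hα.rInter hβ).symm this
  · intro i hi h
    have := (hsteps (n - i) (by omega)).1 (Nat.Odd.sub_odd hn h)
    simpa only [Nat.add_sub_add_right, Nat.sub_add_comm hi] using (hα.rInter hγ).symm this

theorem altComp_step (hd : IsDistribSeq k d) (hα : Equivalence α) (hβ : Equivalence β)
    (hγ : Equivalence γ) (hcα : ∀ i ≤ k, Compat4 α (d i)) (hcβ : ∀ i ≤ k, Compat4 β (d i))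
    (hcγ : ∀ i ≤ k, Compat4 γ (d i)) (hkeven : Even k) {a b c e : A} (hae : α a e)
    (hab : β a b) (hbc : γ b c) (hce : β c e) (j : ℕ) (hj : 2 * j + 2 < k) {x y : A}
    (hax : α a x) (hxd : γ x (d (2 * j + 1) a b c e)) (hay : α a y)
    (hdy : γ (d (2 * j + 3) a b c e) y)
    (h : AltComp (RInter α β) (RInter α γ) ((k - 1) * j + 1) a x) :
    AltComp (RInter α β) (RInter α γ) ((k - 1) * (j + 1) + 1) a y := by
  have hxy : α x y := hα.trans (hα.symm hax) hay
  have hγ' : γ x (d (2 * j + 2) a b c e) :=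
    hγ.trans hxd (hd.odd_step hγ hcγ hbc (by omega) ⟨j, rfl⟩)
  have hαβ : RInter α β (d (2 * j + 2) a b c e) (d (2 * j + 3) a b c e) :=
    have heven : Even (2 * j + 2) := ⟨j + 1, by omega⟩
    ⟨hd.even_step_outer hα hcα hae hj heven, hd.even_step hβ hcβ hab hce hj heven⟩
  have h1 := hd.altComp_of_inner hα hβ hγ hcα hcβ hcγ (by omega) hxy hγ' hαβ hdy
  have h2 := hd.altComp_of_inner_swap hα hβ hγ hcα hcβ hcγ (by omega) hkeven hxy hγ' hαβ hdy
  obtain ⟨n, rfl⟩ : ∃ n, k = n + 1 := ⟨k - 1, by omega⟩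
  exact AltComp.append (n * j) (hα.rInter hβ).trans (hα.rInter hγ).trans h (fun _ => h2)
    (fun _ => h1)

theorem exists_altComp (hd : IsDistribSeq k d) (hα : Equivalence α) (hβ : Equivalence β)
    (hγ : Equivalence γ) (hcα : ∀ i ≤ k, Compat4 α (d i)) (hcβ : ∀ i ≤ k, Compat4 β (d i))
    (hcγ : ∀ i ≤ k, Compat4 γ (d i)) (hkeven : Even k) {a b c e : A} (hae : α a e)
    (hab : β a b) (hbc : γ b c) (hce : β c e) (j : ℕ) (hj : 2 * j + 1 < k) :
    ∃ x, α a x ∧ γ x (d (2 * j + 1) a b c e) ∧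
      AltComp (RInter α β) (RInter α γ) ((k - 1) * j + 1) a x := by
  induction j with
  | zero =>
    have h1 := hd.even_step_outer (q := b) (s := c) hα hcα hae (by omega) Even.zero
    have h2 := hd.even_step hβ hcβ hab hce (by omega) Even.zero
    rw [hd.1] at h1 h2
    exact ⟨d 1 a b c e, h1, hγ.refl _, h1, h2⟩
  | succ j ih =>
    obtain ⟨x, hax, hxd, hx⟩ := ih (by omega)
    have hay := hd.rel_apply hα hj.le (hcα _ hj.le) hae (hα.refl b)
    have hyd := hcγ _ hj.le a b b e a b c e (hγ.refl a) (hγ.refl b) hbc (hγ.refl e)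
    exact ⟨_, hay, hyd, hd.altComp_step hα hβ hγ hcα hcβ hcγ hkeven hae hab hbc hce j
      (by omega) hax hxd hay (hγ.symm hyd) hx⟩

end IsDistribSeq


/-- For even `k ≥ 4`, a distributivity sequence of length `k` yields
`α ∩ (β ∘ γ ∘ β) ⊆ (α ∩ β) ∘_r (α ∩ γ)` with `r = (k² − 3k + 4)/2`
(expressed subtraction-free as `2r + 3k = k² + 4`). -/
theorem stmt3 {A : Type*} (k : ℕ) (hk : 4 ≤ k) (hkeven : Even k)
    (r : ℕ) (hr : 2 * r + 3 * k = k ^ 2 + 4)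
    (d : ℕ → A → A → A → A → A) (hd : IsDistribSeq k d)
    (α β γ : A → A → Prop)
    (hα : Equivalence α) (hβ : Equivalence β) (hγ : Equivalence γ)
    (hcα : ∀ i ≤ k, Compat4 α (d i)) (hcβ : ∀ i ≤ k, Compat4 β (d i))
    (hcγ : ∀ i ≤ k, Compat4 γ (d i)) :
    ∀ a e : A, α a e → RComp β (RComp γ β) a e →
      AltComp (RInter α β) (RInter α γ) r a e := by
  rintro a e hae ⟨b, hab, c, hbc, hce⟩
  obtain ⟨m, rfl⟩ : ∃ m, k = 2 * m + 4 := by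
    obtain ⟨K, hK⟩ := hkeven
    exact ⟨K - 2, by omega⟩
  obtain rfl : r = (2 * m + 3) * (m + 1) + 1 := by nlinarith
  have main := hd.exists_altComp hα hβ hγ hcα hcβ hcγ ⟨m + 2, by omega⟩ hae hab hbc hce
  obtain ⟨x, hax, hxd, hx⟩ := main m (by omega)
  have hlast : d (2 * m + 3) a b b e = e := by
    rw [hd.2.2.2.1 (2 * m + 3) (by omega) ⟨m + 1, by omega⟩, hd.2.2.2.2]
  have hγe : γ (d (2 * m + 3) a b c e) e := by
    simpa only [hlast] using hcγ (2 * m + 3) (by omega) a b c e a b b e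
      (hγ.refl a) (hγ.refl b) (hγ.symm hbc) (hγ.refl e)
  exact hd.altComp_step hα hβ hγ hcα hcβ hcγ ⟨m + 2, by omega⟩ hae hab hbc hce m (by omega)
    hax hxd hae hγe hx
end

section
/- Let A be a type, k ≥ 1, and let d₀, …, d_k : A⁴ → A be a distributivity sequence of length k. Let α and γ be equivalence relations on A compatible with every d_i, and let R be any binary relation on A compatible with every d_i. Set Δ = R ∘ R⁻¹. Then α ∩ (Δ ∘ γ ∘ Δ) ⊆ (α ∩ Δ) ∘_k γ. -/
/-- A chain of `n + 1` links alternately in `ρ` and `σ`, starting with `ρ`, witnesses the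
alternating composition. -/
theorem AltComp.of_chain {A : Type*} (n : ℕ) (ρ σ : A → A → Prop) (f : ℕ → A)
    (hρ : ∀ i < n + 1, Even i → ρ (f i) (f (i + 1)))
    (hσ : ∀ i < n + 1, Odd i → σ (f i) (f (i + 1))) :
    AltComp ρ σ (n + 1) (f 0) (f (n + 1)) := by
  induction n generalizing ρ σ f with
  | zero => exact hρ 0 (by omega) Even.zero
  | succ n ih =>
    refine ⟨f 1, hρ 0 (by omega) Even.zero, ih σ ρ (fun i => f (i + 1)) ?_ ?_⟩
    · exact fun i hi he => hσ (i + 1) (by omega) he.add_one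
    · exact fun i hi ho => hρ (i + 1) (by omega) ho.add_one

/-- For `Δ = R ∘ R⁻¹` with `R` an admissible (compatible) relation, a
distributivity sequence of length `k ≥ 1` yields `α ∩ (Δ ∘ γ ∘ Δ) ⊆ (α ∩ Δ) ∘_k γ`. -/
theorem stmt7 {A : Type*} (k : ℕ) (hk : 1 ≤ k) (d : ℕ → A → A → A → A → A)
    (hd : IsDistribSeq k d) (α γ R : A → A → Prop)
    (hα : Equivalence α) (hγ : Equivalence γ)
    (hcα : ∀ i ≤ k, Compat4 α (d i)) (hcγ : ∀ i ≤ k, Compat4 γ (d i))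
    (hcR : ∀ i ≤ k, Compat4 R (d i)) :
    ∀ a e : A, α a e →
      RComp (RComp R (RConv R)) (RComp γ (RComp R (RConv R))) a e →
      AltComp (RInter α (RComp R (RConv R))) γ k a e := by
  rintro a e hae ⟨b, ⟨p, hap, hbp⟩, c, hbc, q, hcq, heq⟩
  obtain ⟨h0, hdiag, hends, hmid, hk'⟩ := hd
  obtain ⟨n, rfl⟩ : ∃ n, k = n + 1 := ⟨k - 1, by omega⟩
  have key := AltComp.of_chain n (RInter α (RComp R (RConv R))) γ (fun i => d i a b c e) ?_ ?_
  · simpa only [h0, hk'] using key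
  · intro i hi he
    have toα : ∀ j ≤ n + 1, α (d j a b c e) (d j a b c a) := fun j hj =>
      hcα j hj _ _ _ _ _ _ _ _ (hα.refl a) (hα.refl b) (hα.refl c) (hα.symm hae)
    have toR : ∀ j ≤ n + 1, R (d j a b c e) (d j p p q q) := fun j hj =>
      hcR j hj _ _ _ _ _ _ _ _ hap hbp hcq heq
    refine ⟨hα.trans (toα i hi.le) ?_, d i p p q q, toR i hi.le, ?_⟩
    · rw [hends i hi he]
      exact hα.symm (toα (i + 1) hi)
    · rw [hdiag i hi he]
      exact toR (i + 1) hi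
  · intro i hi ho
    have toγ : ∀ j ≤ n + 1, γ (d j a b c e) (d j a b b e) := fun j hj =>
      hcγ j hj _ _ _ _ _ _ _ _ (hγ.refl a) (hγ.refl b) (hγ.symm hbc) (hγ.refl e)
    refine hγ.trans (toγ i hi.le) ?_
    rw [hmid i hi ho]
    exact hγ.symm (toγ (i + 1) hi)
end
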